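/- Let B be a Boolean contact algebra satisfying (DV6) and (C5). Then every W-representative of B that is ω-abstractive is a G-representative. -/

import Mathlib

variable {B : Type*} [BooleanAlgebra B]

/-- A Boolean contact algebra structure on a Boolean algebra `B`. -/
structure BCA (B : Type*) [BooleanAlgebra B] where
  C : B → B → Prop
  c0 : ∀ x : B, ¬ C ⊥ x
  c1 : ∀ x y : B, x ≠ ⊥ → x ≤ y → C x y
  c2 : ∀ x y : B, C x y → C y x
  c3 : ∀ x y z : B, x ≤ y → C z x → C z y
  c4 : ∀ x y z : B, C x (y ⊔ z) → C x y ∨ C x z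

namespace BCA

/-- The well-inside relation: `x ≪ y` iff `¬ (x C yᶜ)`. -/
def wi (A : BCA B) (x y : B) : Prop := ¬ A.C x yᶜ

/-- `Q₁` covers `Q₂` iff every element of `Q₁` contains some element of `Q₂`. -/
def Covers (Q₁ Q₂ : Set B) : Prop := ∀ x ∈ Q₁, ∃ y ∈ Q₂, y ≤ x

/-- A Grzegorczyk representative of a point. -/
def IsGRep (A : BCA B) (Q : Set B) : Prop :=
  Q.Nonempty ∧ (⊥ : B) ∉ Q ∧
    (∀ u ∈ Q, ∀ v ∈ Q, u = v ∨ A.wi u v ∨ A.wi v u) ∧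
    (∀ u ∈ Q, ∃ v ∈ Q, A.wi v u) ∧
    (∀ x y : B, (∀ u ∈ Q, u ⊓ x ≠ ⊥ ∧ u ⊓ y ≠ ⊥) → A.C x y)

/-- An abstractive set. -/
def IsAbstractive (A : BCA B) (S : Set B) : Prop :=
  S.Nonempty ∧ (⊥ : B) ∉ S ∧
    (∀ u ∈ S, ∀ v ∈ S, u = v ∨ A.wi u v ∨ A.wi v u) ∧
    ¬ ∃ x ∈ S, ∀ y ∈ S, x ≤ y

/-- A Whitehead representative of a point. -/
def IsWRep (A : BCA B) (S : Set B) : Prop :=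
  A.IsAbstractive S ∧ ∀ T : Set B, A.IsAbstractive T → Covers S T → Covers T S

/-- An ω-abstractive set: an abstractive set mutually covering with a countable abstractive set. -/
def IsOmegaAbstractive (A : BCA B) (S : Set B) : Prop :=
  A.IsAbstractive S ∧
    ∃ T : Set B, T.Countable ∧ A.IsAbstractive T ∧ Covers S T ∧ Covers T S

/-- A filter of the Boolean algebra `B`. -/
def IsFilter (F : Set B) : Prop :=
  F.Nonempty ∧ (⊥ : B) ∉ F ∧
    (∀ x ∈ F, ∀ y : B, x ≤ y → y ∈ F) ∧
    (∀ x ∈ F, ∀ y ∈ F, x ⊓ y ∈ F)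

/-- A round filter. -/
def IsRoundFilter (A : BCA B) (F : Set B) : Prop :=
  IsFilter F ∧ ∀ x ∈ F, ∃ y ∈ F, A.wi y x

/-- A Grzegorczyk point: the filter generated by a G-representative. -/
def IsGPoint (A : BCA B) (G : Set B) : Prop :=
  ∃ Q : Set B, A.IsGRep Q ∧ G = {y : B | ∃ x ∈ Q, x ≤ y}

/-- Atomlessness of the Boolean algebra. -/
def Atomless (B : Type*) [BooleanAlgebra B] : Prop :=
  ∀ x : B, x ≠ ⊥ → ∃ y : B, y ≠ ⊥ ∧ y < x

/-- The interpolation axiom (DV6). -/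
def DV6 (A : BCA B) : Prop := ∀ x y : B, A.wi x y → ∃ z : B, A.wi x z ∧ A.wi z y

/-- The non-tangential part axiom (DV7). -/
def DV7 (A : BCA B) : Prop := ∀ x : B, x ≠ ⊥ → ∃ y : B, y ≠ ⊥ ∧ A.wi y x

/-- The connectedness axiom (C5). -/
def C5 (A : BCA B) : Prop := ∀ x : B, x ≠ ⊥ → x ≠ ⊤ → A.C x xᶜ

/-- The countable chain condition for a Boolean algebra. -/
def CCC (B : Type*) [BooleanAlgebra B] : Prop :=
  ∀ S : Set B, (∀ x ∈ S, x ≠ ⊥) → (S.Pairwise fun x y => x ⊓ y = ⊥) → S.Countable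

end BCA

namespace BCA

theorem wi.le {A : BCA B} {x y : B} (h : A.wi x y) : x ≤ y := by
  by_contra hxy
  have hne : x ⊓ yᶜ ≠ ⊥ := fun h0 => hxy (by rwa [← sdiff_eq, sdiff_eq_bot_iff] at h0)
  exact h (A.c2 _ _ (A.c3 _ _ _ inf_le_left
    (A.c2 _ _ (A.c1 (x ⊓ yᶜ) yᶜ hne inf_le_right))))

theorem wi.mono {A : BCA B} {x y x' y' : B} (h : A.wi x y) (hx : x' ≤ x) (hy : y ≤ y') :
    A.wi x' y' := fun hC =>
  h (A.c2 _ _ (A.c3 _ _ _ hx (A.c2 _ _ (A.c3 _ _ _ (compl_le_compl hy) hC))))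

theorem wi.inf {A : BCA B} {x y x' y' : B} (h : A.wi x y) (h' : A.wi x' y') :
    A.wi (x ⊓ x') (y ⊓ y') := by
  intro hC
  rw [compl_inf] at hC
  rcases A.c4 _ _ _ hC with h1 | h1
  · exact h.mono inf_le_left le_rfl h1
  · exact h'.mono inf_le_right le_rfl h1

theorem wi_of_lt_of_forall_succ {A : BCA B} {w : ℕ → B} (hw : ∀ n, A.wi (w (n + 1)) (w n))
    {m n : ℕ} (hmn : m < n) : A.wi (w n) (w m) :=
  (hw m).mono (antitone_nat_of_succ_le (fun k => (hw k).le) hmn) le_rfl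

theorem IsAbstractive.exists_wi {A : BCA B} {S : Set B} (hS : A.IsAbstractive S) {u : B}
    (hu : u ∈ S) : ∃ v ∈ S, A.wi v u := by
  obtain ⟨-, -, hchain, hmin⟩ := hS
  by_contra! hno
  refine hmin ⟨u, hu, fun v hv => ?_⟩
  rcases hchain u hu v hv with rfl | h | h
  · exact le_rfl
  · exact h.le
  · exact (hno v hv h).elim

theorem IsAbstractive.exists_wi_le {A : BCA B} {S : Set B} (hS : A.IsAbstractive S) {u v : B}
    (hu : u ∈ S) (hv : v ∈ S) : ∃ c ∈ S, A.wi c u ∧ c ≤ v := by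
  rcases hS.2.2.1 u hu v hv with rfl | h | h
  · obtain ⟨c, hc, hcu⟩ := hS.exists_wi hu
    exact ⟨c, hc, hcu, hcu.le⟩
  · obtain ⟨c, hc, hcu⟩ := hS.exists_wi hu
    exact ⟨c, hc, hcu, hcu.le.trans h.le⟩
  · exact ⟨v, hv, h, le_rfl⟩

theorem exists_seq_of_forall_exists {α : Type*} {P : α → Prop} {R : ℕ → α → α → Prop} {a : α}
    (ha : P a) (h : ∀ n a, P a → ∃ b, P b ∧ R n a b) :
    ∃ f : ℕ → α, f 0 = a ∧ (∀ n, P (f n)) ∧ ∀ n, R n (f n) (f (n + 1)) := by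
  choose g hg hR using h
  let F : ℕ → {a // P a} := fun n => Nat.rec ⟨a, ha⟩ (fun n p => ⟨g n p.1 p.2, hg n p.1 p.2⟩) n
  exact ⟨fun n => (F n).1, rfl, fun n => (F n).2, fun n => hR n _ _⟩

/-- A countable abstractive set has a coinitial sequence descending along `≪`. -/
theorem IsAbstractive.exists_seq {A : BCA B} {T : Set B} (hT : A.IsAbstractive T)
    (hc : T.Countable) : ∃ t : ℕ → B, (∀ n, t n ∈ T) ∧ (∀ n, A.wi (t (n + 1)) (t n)) ∧
      ∀ u ∈ T, ∃ n, t n ≤ u := by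
  obtain ⟨e, rfl⟩ := hc.exists_eq_range hT.1
  obtain ⟨t, -, htT, ht⟩ := exists_seq_of_forall_exists
    (P := (· ∈ Set.range e)) (R := fun n a b => A.wi b a ∧ b ≤ e n)
    (Set.mem_range_self 0) fun n a ha => hT.exists_wi_le ha (Set.mem_range_self n)
  refine ⟨t, htT, fun n => (ht n).1, ?_⟩
  rintro _ ⟨n, rfl⟩
  exact ⟨n + 1, (ht n).2⟩

theorem DV6.exists_seq {A : BCA B} (h : A.DV6) {x z : B} (hxz : A.wi x z) :
    ∃ f : ℕ → B, f 0 = z ∧ (∀ n, A.wi x (f n)) ∧ ∀ n, A.wi (f (n + 1)) (f n) :=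
  exists_seq_of_forall_exists (P := A.wi x) (R := fun _ a b => A.wi b a) hxz
    fun _ a ha => h x a ha

theorem C5.eq_bot_or_eq_top {A : BCA B} (h : A.C5) {x : B} (hx : A.wi x x) :
    x = ⊥ ∨ x = ⊤ := by
  by_contra! hne
  exact hx (h x hne.1 hne.2)

theorem isAbstractive_range {A : BCA B} (h : A.C5) {w : ℕ → B}
    (hw : ∀ n, A.wi (w (n + 1)) (w n)) (hbot : ∀ n, w n ≠ ⊥) (htop : ∀ n, w n ≠ ⊤) :
    A.IsAbstractive (Set.range w) := by
  refine ⟨Set.range_nonempty w, ?_, ?_, ?_⟩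
  · rintro ⟨n, hn⟩
    exact hbot n hn
  · rintro _ ⟨m, rfl⟩ _ ⟨n, rfl⟩
    rcases lt_trichotomy m n with hmn | rfl | hmn
    · exact Or.inr (Or.inr (wi_of_lt_of_forall_succ hw hmn))
    · exact Or.inl rfl
    · exact Or.inr (Or.inl (wi_of_lt_of_forall_succ hw hmn))
  · rintro ⟨_, ⟨n, rfl⟩, hn⟩
    have hle : w n ≤ w (n + 1) := hn _ (Set.mem_range_self _)
    rcases h.eq_bot_or_eq_top ((hw n).mono hle le_rfl) with h0 | h1
    · exact hbot n h0
    · exact htop n h1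

end BCA


theorem stmt_7 {B : Type*} [BooleanAlgebra B] (A : BCA B)
    (hdv6 : A.DV6) (hc5 : A.C5) (S : Set B)
    (hW : A.IsWRep S) (hω : A.IsOmegaAbstractive S) : A.IsGRep S := by
  obtain ⟨-, T, hTc, hT, hST, hTS⟩ := hω
  refine ⟨hW.1.1, hW.1.2.1, hW.1.2.2.1, fun u hu => hW.1.exists_wi hu, fun x y hxy => ?_⟩
  by_contra hC
  have hwi : A.wi x yᶜ := by rwa [BCA.wi, compl_compl]
  obtain ⟨t, htT, ht, htcof⟩ := hT.exists_seq hTc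
  obtain ⟨f, hf0, hxf, hf⟩ := hdv6.exists_seq hwi
  have hf_le : ∀ n, f n ≤ yᶜ := fun n =>
    hf0 ▸ antitone_nat_of_succ_le (fun k => (hf k).le) n.zero_le
  have hdisj : ∀ s ∈ S, ∀ n, ¬ s ≤ t n ⊓ f n := fun s hs n hle =>
    (hxy s hs).2 (disjoint_iff.mp
      (le_compl_iff_disjoint_right.mp (hle.trans (inf_le_right.trans (hf_le n)))))
  have habs : A.IsAbstractive (Set.range fun n => t n ⊓ f n) := by
    refine BCA.isAbstractive_range hc5 (fun n => (ht n).inf (hf n)) (fun n h0 => ?_)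
      (fun n h1 => ?_)
    · obtain ⟨s, hs, hst⟩ := hTS _ (htT n)
      exact (hxy s hs).1 (le_bot_iff.mp (h0 ▸ inf_le_inf hst (hxf n).le))
    · obtain ⟨s, hs⟩ := hW.1.1
      exact hdisj s hs n (le_top.trans_eq h1.symm)
  have hcov : BCA.Covers S (Set.range fun n => t n ⊓ f n) := by
    intro s hs
    obtain ⟨u, hu, hus⟩ := hST s hs
    obtain ⟨n, hn⟩ := htcof u hu
    exact ⟨_, Set.mem_range_self n, inf_le_left.trans (hn.trans hus)⟩
  obtain ⟨s, hs, hle⟩ := hW.2 _ habs hcov _ (Set.mem_range_self 0)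
  exact hdisj s hs 0 hle
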